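/- Let a, b, n be real numbers with 0 < a ≤ n and 0 < b ≤ n, and let P = {(ta, tb) : t ∈ [0, 1]} be the closed line segment from (0, 0) to (a, b). Then px(n, P) = (a + b)·n − a·b. -/

import Mathlib

open MeasureTheory Set
open scoped ENNReal

/-- `S` contains `P` (for subsets of `ℝ²`). -/
def PContains (S P : Set (ℝ × ℝ)) : Prop :=
  ∃ fX fY : ℝ → ℝ,
    (∀ x₀ x₁ : ℝ, (∃ y, (x₀, y) ∈ P) → (∃ y, (x₁, y) ∈ P) → x₁ < x₀ →
      x₀ - x₁ ≤ fX x₀ - fX x₁) ∧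
    (∀ y₀ y₁ : ℝ, (∃ x, (x, y₀) ∈ P) → (∃ x, (x, y₁) ∈ P) → y₁ < y₀ →
      y₀ - y₁ ≤ fY y₀ - fY y₁) ∧
    (∀ p ∈ P, (fX p.1, fY p.2) ∈ S)

/-- `px n P`: supremum of the planar Lebesgue measure of open `P`-free subsets of `[0,n]²`. -/
noncomputable def px (n : ℝ) (P : Set (ℝ × ℝ)) : ℝ≥0∞ :=
  sSup {m : ℝ≥0∞ | ∃ S : Set (ℝ × ℝ), IsOpen S ∧ S ⊆ Set.Icc (0, 0) (n, n) ∧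
    ¬ PContains S P ∧ m = volume S}

/-- The distribution function of a compact set grows at most as fast as the identity. -/
theorem measureReal_inter_Iic_le_add {K : Set ℝ} (hK : IsCompact K) (x y : ℝ) (hxy : x ≤ y) :
    volume.real (K ∩ Iic y) ≤ volume.real (K ∩ Iic x) + (y - x) := by
  have hfin : volume (K ∩ Iic x) ≠ ∞ := measure_ne_top_of_subset inter_subset_left hK.measure_ne_top
  calc volume.real (K ∩ Iic y) ≤ volume.real ((K ∩ Iic x) ∪ Ioc x y) := by
        refine measureReal_mono ?_ (measure_union_ne_top hfin (by simp))
        rintro z ⟨hz, hzy⟩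
        rcases le_or_gt z x with h | h
        · exact Or.inl ⟨hz, h⟩
        · exact Or.inr ⟨h, hzy⟩
    _ ≤ volume.real (K ∩ Iic x) + volume.real (Ioc x y) := measureReal_union_le _ _
    _ = _ := by rw [Real.volume_real_Ioc_of_le hxy]

/-- An intermediate value of the distribution function of a compact set is attained in the set. -/
theorem exists_mem_measureReal_inter_Iic_eq {K : Set ℝ} (hK : IsCompact K) {s : ℝ} (hs : 0 < s)
    (hsK : s ≤ volume.real K) : ∃ x ∈ K, volume.real (K ∩ Iic x) = s := by
  have hmono : Monotone fun x => volume.real (K ∩ Iic x) := fun x y hxy =>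
    measureReal_mono (by gcongr) (measure_ne_top_of_subset inter_subset_left hK.measure_ne_top)
  have hcont : Continuous fun x => volume.real (K ∩ Iic x) := by
    refine (LipschitzWith.of_le_add fun x y => ?_).continuous
    rcases le_total x y with h | h
    · exact (hmono h).trans (le_add_of_nonneg_right dist_nonneg)
    · rw [Real.dist_eq, abs_of_nonneg (sub_nonneg.2 h)]
      exact measureReal_inter_Iic_le_add hK y x h
  obtain ⟨l, hl⟩ := hK.bddBelow
  obtain ⟨u, hu⟩ := hK.bddAbove
  have hlow : volume.real (K ∩ Iic (l - 1)) = 0 := by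
    have : K ∩ Iic (l - 1) = ∅ := by
      ext z
      simp only [mem_inter_iff, mem_Iic, mem_empty_iff_false, iff_false, not_and, not_le]
      intro hz
      linarith [hl hz]
    simp [this]
  have hupp : volume.real (K ∩ Iic u) = volume.real K := by
    rw [inter_eq_left.2 (show K ⊆ Iic u from fun z hz => hu hz)]
  obtain ⟨x, hx⟩ := mem_range_of_exists_le_of_exists_ge (c := s) hcont
    ⟨l - 1, by rw [hlow]; exact hs.le⟩ ⟨u, by rw [hupp]; exact hsK⟩
  have hne : (K ∩ Iic x).Nonempty := by
    by_contra h
    simp only [not_nonempty_iff_eq_empty.1 h, measureReal_empty] at hx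
    exact hs.ne hx
  obtain ⟨z, ⟨hzK, hzx⟩, hz⟩ := (hK.inter_right isClosed_Iic).exists_isGreatest hne
  refine ⟨z, hzK, ?_⟩
  rw [← hx]
  congr 1
  exact Subset.antisymm (inter_subset_inter_right _ (Iic_subset_Iic.2 hzx))
    fun w hw => ⟨hw.1, hz hw⟩

/-- An open subset of the line of measure greater than `b` contains an expanding image of
`[0, b]`. -/
theorem exists_expanding_mem_of_lt_volume {U : Set ℝ} (hU : IsOpen U) {b : ℝ} (hb : 0 ≤ b)
    (h : ENNReal.ofReal b < volume U) :
    ∃ g : ℝ → ℝ, (∀ t ∈ Icc 0 b, g t ∈ U) ∧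
      ∀ s ∈ Icc 0 b, ∀ t ∈ Icc 0 b, s < t → t - s ≤ g t - g s := by
  obtain ⟨K, hKU, hK, hbK⟩ := hU.exists_lt_isCompact h
  have hbm : b < volume.real K := (ENNReal.ofReal_lt_iff_lt_toReal hb hK.measure_ne_top).1 hbK
  have hex : ∀ t, ∃ x, t ∈ Icc 0 b →
      x ∈ K ∧ volume.real (K ∩ Iic x) = t + (volume.real K - b) := by
    intro t
    by_cases ht : t ∈ Icc 0 b
    · obtain ⟨x, hx⟩ := exists_mem_measureReal_inter_Iic_eq hK
        (s := t + (volume.real K - b)) (by linarith [ht.1]) (by linarith [ht.2])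
      exact ⟨x, fun _ => hx⟩
    · exact ⟨0, fun h => absurd h ht⟩
  choose g hg using hex
  refine ⟨g, fun t ht => hKU (hg t ht).1, fun s hs t ht hst => ?_⟩
  have h1 := (hg s hs).2
  have h2 := (hg t ht).2
  rcases le_total (g s) (g t) with h | h
  · linarith [measureReal_inter_Iic_le_add hK _ _ h]
  · have : volume.real (K ∩ Iic (g t)) ≤ volume.real (K ∩ Iic (g s)) :=
      measureReal_mono (by gcongr) (measure_ne_top_of_subset inter_subset_left hK.measure_ne_top)
    linarith

/-- If `S` avoids the segment from `(0, 0)` to `(a, b)`, then every line parallel to the segment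
meets `S` in a set whose projection to the second axis has measure at most `b`. -/
theorem volume_section_le_of_not_pContains {a b : ℝ} (ha : 0 < a) (hb : 0 < b) {S : Set (ℝ × ℝ)}
    (hS : IsOpen S)
    (hP : ¬ PContains S ((fun t : ℝ => (t * a, t * b)) '' Icc (0 : ℝ) 1)) (c : ℝ) :
    volume {y : ℝ | (c + a / b * y, y) ∈ S} ≤ ENNReal.ofReal b := by
  by_contra! hlt
  have hU : IsOpen {y : ℝ | (c + a / b * y, y) ∈ S} :=
    hS.preimage (f := fun y : ℝ => (c + a / b * y, y)) (by fun_prop)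
  obtain ⟨g, hgU, hg⟩ := exists_expanding_mem_of_lt_volume hU hb.le hlt
  have hmem : ∀ t ∈ Icc (0 : ℝ) 1, t * b ∈ Icc 0 b := fun t ht =>
    ⟨mul_nonneg ht.1 hb.le, mul_le_of_le_one_left hb.le ht.2⟩
  have hscale : ∀ t : ℝ, t * a / (a / b) = t * b := fun t => by field_simp
  refine hP ⟨fun x => c + a / b * g (x / (a / b)), g, ?_, ?_, ?_⟩
  · rintro _ _ ⟨_, s, hs, hs'⟩ ⟨_, t, ht, ht'⟩ hlt
    obtain ⟨rfl, -⟩ := Prod.mk.inj hs'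
    obtain ⟨rfl, -⟩ := Prod.mk.inj ht'
    have hts : t < s := lt_of_mul_lt_mul_right hlt ha.le
    have key := hg _ (hmem t ht) _ (hmem s hs) (mul_lt_mul_of_pos_right hts hb)
    simp only [hscale]
    calc s * a - t * a = a / b * (s * b - t * b) := by field_simp
      _ ≤ a / b * (g (s * b) - g (t * b)) := by gcongr
      _ = _ := by ring
  · rintro _ _ ⟨_, s, hs, hs'⟩ ⟨_, t, ht, ht'⟩ hlt
    obtain ⟨-, rfl⟩ := Prod.mk.inj hs'
    obtain ⟨-, rfl⟩ := Prod.mk.inj ht'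
    exact hg _ (hmem t ht) _ (hmem s hs) hlt
  · rintro _ ⟨t, ht, rfl⟩
    simp only [hscale]
    exact hgU _ (hmem t ht)

/-- The open square `(0, n)²` with its upper right corner `[a, n) × [b, n)` removed. -/
def cornerRemoved (a b n : ℝ) : Set (ℝ × ℝ) :=
  (Ioo 0 n ×ˢ Ioo 0 n) \ (Ici a ×ˢ Ici b)

theorem isOpen_cornerRemoved (a b n : ℝ) : IsOpen (cornerRemoved a b n) :=
  (isOpen_Ioo.prod isOpen_Ioo).sdiff (isClosed_Ici.prod isClosed_Ici)

theorem volume_cornerRemoved {a b n : ℝ} (ha : 0 < a) (han : a ≤ n) (hb : 0 < b) (hbn : b ≤ n) :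
    volume (cornerRemoved a b n) = ENNReal.ofReal ((a + b) * n - a * b) := by
  have hset : cornerRemoved a b n = (Ioo 0 n ×ˢ Ioo 0 n) \ (Ico a n ×ˢ Ico b n) := by
    ext ⟨x, y⟩
    simp only [cornerRemoved, mem_sdiff, mem_prod, mem_Ioo, mem_Ici, mem_Ico]
    tauto
  have hsub : Ico a n ×ˢ Ico b n ⊆ Ioo 0 n ×ˢ Ioo 0 n :=
    prod_mono (fun x hx => ⟨ha.trans_le hx.1, hx.2⟩) (fun x hx => ⟨hb.trans_le hx.1, hx.2⟩)
  have hcorner : volume (Ico a n ×ˢ Ico b n) = ENNReal.ofReal ((n - a) * (n - b)) := by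
    rw [Measure.volume_eq_prod, Measure.prod_prod, Real.volume_Ico, Real.volume_Ico,
      ENNReal.ofReal_mul (sub_nonneg.2 han)]
  have hsquare : volume (Ioo 0 n ×ˢ Ioo 0 n) = ENNReal.ofReal (n * n) := by
    rw [Measure.volume_eq_prod, Measure.prod_prod, Real.volume_Ioo, sub_zero,
      ENNReal.ofReal_mul (ha.le.trans han)]
  rw [hset, measure_sdiff hsub (measurableSet_Ico.prod measurableSet_Ico).nullMeasurableSet
    (by rw [hcorner]; exact ENNReal.ofReal_ne_top), hcorner, hsquare,
    ← ENNReal.ofReal_sub _ (mul_nonneg (sub_nonneg.2 han) (sub_nonneg.2 hbn))]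
  congr 1
  ring

theorem not_pContains_cornerRemoved {a b : ℝ} (n : ℝ) (ha : 0 < a) (hb : 0 < b) :
    ¬ PContains (cornerRemoved a b n) ((fun t : ℝ => (t * a, t * b)) '' Icc (0 : ℝ) 1) := by
  rintro ⟨fX, fY, hX, hY, hS⟩
  have h0 : ((0 : ℝ), (0 : ℝ)) ∈ (fun t : ℝ => (t * a, t * b)) '' Icc (0 : ℝ) 1 :=
    ⟨0, by simp, by simp⟩
  have h1 : (a, b) ∈ (fun t : ℝ => (t * a, t * b)) '' Icc (0 : ℝ) 1 := ⟨1, by simp, by simp⟩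
  have hx := hX a 0 ⟨b, h1⟩ ⟨0, h0⟩ ha
  have hy := hY b 0 ⟨a, h1⟩ ⟨0, h0⟩ hb
  have hpos := (hS _ h0).1
  simp only [mem_prod, mem_Ioo] at hpos
  refine (hS _ h1).2 ⟨?_, ?_⟩
  · simp only [mem_Ici]
    linarith [hpos.1.1]
  · simp only [mem_Ici]
    linarith [hpos.2.1]

/-- Fubini's theorem along the lines of a fixed slope. -/
theorem volume_eq_lintegral_shear (r : ℝ) {S : Set (ℝ × ℝ)} (hS : MeasurableSet S) :
    volume S = ∫⁻ c : ℝ, volume {y : ℝ | (c + r * y, y) ∈ S} := by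
  have hshear : MeasurePreserving (fun p : ℝ × ℝ => (p.1, p.2 + r * p.1))
      (volume.prod volume) (volume.prod volume) :=
    (MeasurePreserving.id (volume : Measure ℝ)).skew_product (g := fun y c => c + r * y)
      (by fun_prop) (ae_of_all _ fun y => map_add_right_eq_self volume (r * y))
  have hmp : MeasurePreserving (fun p : ℝ × ℝ => (p.1 + r * p.2, p.2))
      (volume.prod volume) (volume.prod volume) :=
    (Measure.measurePreserving_swap.comp hshear).comp Measure.measurePreserving_swap
  rw [Measure.volume_eq_prod, ← hmp.measure_preimage hS.nullMeasurableSet,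
    Measure.prod_apply (hmp.measurable hS)]
  rfl

/-- A line of positive slope meets an `S ⊆ [0, n]²` avoiding the segment in no more than it meets
the square with its corner removed. -/
theorem volume_section_le_cornerRemoved {a b n : ℝ} (ha : 0 < a) (hb : 0 < b) {S : Set (ℝ × ℝ)}
    (hS : IsOpen S) (hSn : S ⊆ Icc (0, 0) (n, n))
    (hP : ¬ PContains S ((fun t : ℝ => (t * a, t * b)) '' Icc (0 : ℝ) 1)) (c : ℝ) :
    volume {y : ℝ | (c + a / b * y, y) ∈ S} ≤
      volume {y : ℝ | (c + a / b * y, y) ∈ cornerRemoved a b n} := by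
  set r := a / b with hr
  have hr0 : 0 < r := div_pos ha hb
  have hrb : r * b = a := by rw [hr]; field_simp
  set y₀ := max 0 (-c / r)
  set y₁ := min n ((n - c) / r)
  have hlen : volume {y : ℝ | (c + r * y, y) ∈ S} ≤ ENNReal.ofReal (y₁ - y₀) := by
    rw [← Real.volume_Icc]
    refine measure_mono fun y hy => ?_
    obtain ⟨⟨h1, h2⟩, h3, h4⟩ := hSn hy
    simp only at h1 h2 h3 h4
    refine ⟨max_le h2 ?_, le_min h4 ?_⟩
    · rw [div_le_iff₀ hr0]; linarith
    · rw [le_div_iff₀ hr0]; linarith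
  have hlb := volume_section_le_of_not_pContains ha hb hS hP c
  calc volume {y : ℝ | (c + r * y, y) ∈ S} ≤ ENNReal.ofReal (min (y₁ - y₀) b) := by
        rw [ENNReal.ofReal_min]
        exact le_min hlen hlb
    _ = volume (Ioo y₀ (min y₁ (y₀ + b))) := by
        rw [Real.volume_Ioo, ← min_sub_sub_right y₁ (y₀ + b), add_sub_cancel_left]
    _ ≤ _ := by
        refine measure_mono fun y hy => ?_
        obtain ⟨hy0, hy1⟩ := hy
        obtain ⟨h0, hc0⟩ := max_lt_iff.1 hy0
        obtain ⟨hy1, hyb⟩ := lt_min_iff.1 hy1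
        obtain ⟨hn, hcn⟩ := lt_min_iff.1 hy1
        rw [div_lt_iff₀ hr0] at hc0
        rw [lt_div_iff₀ hr0] at hcn
        refine ⟨⟨⟨by simp only; linarith, by simp only; linarith⟩, h0, hn⟩, ?_⟩
        rintro ⟨hxa, hyb'⟩
        simp only [mem_Ici] at hxa hyb'
        have : y - b < y₀ := by linarith
        rcases lt_max_iff.1 this with h | h
        · linarith
        · rw [lt_div_iff₀ hr0] at h
          linarith

theorem px_diagonal_segment (a b n : ℝ) (ha : 0 < a) (han : a ≤ n) (hb : 0 < b)
    (hbn : b ≤ n) :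
    px n ((fun t : ℝ => (t * a, t * b)) '' Set.Icc (0 : ℝ) 1) =
      ENNReal.ofReal ((a + b) * n - a * b) := by
  rw [← volume_cornerRemoved ha han hb hbn]
  refine le_antisymm (sSup_le ?_) (le_sSup ⟨_, isOpen_cornerRemoved a b n, ?_,
    not_pContains_cornerRemoved n ha hb, rfl⟩)
  · rintro _ ⟨S, hS, hSn, hP, rfl⟩
    rw [volume_eq_lintegral_shear (a / b) hS.measurableSet,
      volume_eq_lintegral_shear (a / b) (isOpen_cornerRemoved a b n).measurableSet]
    exact lintegral_mono fun c => volume_section_le_cornerRemoved ha hb hS hSn hP c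
  · rintro ⟨x, y⟩ ⟨⟨hx, hy⟩, -⟩
    exact ⟨⟨hx.1.le, hy.1.le⟩, hx.2.le, hy.2.le⟩
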